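/- The number of orbits of the alternating group A_5 (the alternating group on 5 letters) acting by simultaneous conjugation on the set of quadruples {(a, b, c, d) ∈ A_5⁴ : a·b = b·a and c·d = d·c} is exactly 1841. (Equivalently, the number of conjugacy classes of homomorphisms from the free product (ℤ × ℤ) ∗ (ℤ × ℤ) to A_5 is 1841.) -/

import Mathlib

open Finset

section Burnside

variable {G : Type*} [Group G]

/-- Quadruples whose first pair commutes and whose second pair commutes, as a subset stable under
simultaneous conjugation. -/
def commutingQuadruples (G : Type*) [Group G] : SubMulAction (ConjAct G) (G × G × G × G) where
  carrier := {p | p.1 * p.2.1 = p.2.1 * p.1 ∧ p.2.2.1 * p.2.2.2 = p.2.2.2 * p.2.2.1}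
  smul_mem' g p hp := by
    obtain ⟨h₁, h₂⟩ := hp
    refine ⟨?_, ?_⟩
    · simp only [Prod.smul_fst, Prod.smul_snd, ← smul_mul', h₁]
    · simp only [Prod.smul_fst, Prod.smul_snd, ← smul_mul', h₂]

/-- Commuting pairs in the centralizer of `g`. -/
abbrev CommutingPairsIn (g : G) : Type _ :=
  {p : G × G // p.1 * p.2 = p.2 * p.1 ∧ g * p.1 = p.1 * g ∧ g * p.2 = p.2 * g}

theorem conjAct_smul_eq_iff (g : ConjAct G) (a : G) :
    g • a = a ↔ ConjAct.ofConjAct g * a = a * ConjAct.ofConjAct g := by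
  rw [ConjAct.smul_def, mul_inv_eq_iff_eq_mul]

/-- A quadruple fixed by `g` amounts to two commuting pairs in the centralizer of `g`. -/
def fixedByCommutingQuadruplesEquiv (g : ConjAct G) :
    MulAction.fixedBy (commutingQuadruples G) g ≃
      CommutingPairsIn (ConjAct.ofConjAct g) × CommutingPairsIn (ConjAct.ofConjAct g) where
  toFun x :=
    have h : g • x.1.1 = x.1.1 := congrArg Subtype.val x.2
    (⟨(x.1.1.1, x.1.1.2.1), x.1.2.1,
        (conjAct_smul_eq_iff _ _).1 (congrArg (fun p => p.1) h),
        (conjAct_smul_eq_iff _ _).1 (congrArg (fun p => p.2.1) h)⟩,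
      ⟨(x.1.1.2.2.1, x.1.1.2.2.2), x.1.2.2,
        (conjAct_smul_eq_iff _ _).1 (congrArg (fun p => p.2.2.1) h),
        (conjAct_smul_eq_iff _ _).1 (congrArg (fun p => p.2.2.2) h)⟩)
  invFun y :=
    ⟨⟨(y.1.1.1, y.1.1.2, y.2.1.1, y.2.1.2), y.1.2.1, y.2.2.1⟩, Subtype.ext <|
      Prod.ext ((conjAct_smul_eq_iff _ _).2 y.1.2.2.1) <|
      Prod.ext ((conjAct_smul_eq_iff _ _).2 y.1.2.2.2) <|
      Prod.ext ((conjAct_smul_eq_iff _ _).2 y.2.2.2.1) ((conjAct_smul_eq_iff _ _).2 y.2.2.2.2)⟩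
  left_inv _ := rfl
  right_inv _ := rfl

theorem card_orbits_commutingQuadruples_mul_card [Fintype G] :
    Nat.card (MulAction.orbitRel.Quotient (ConjAct G) (commutingQuadruples G)) * Nat.card G =
      ∑ g : G, Nat.card (CommutingPairsIn g) ^ 2 := by
  classical
  have : Fintype (ConjAct G) := Fintype.ofEquiv G ConjAct.toConjAct.toEquiv
  have : Finite (commutingQuadruples G) := Subtype.finite
  have : Fintype (MulAction.orbitRel.Quotient (ConjAct G) (commutingQuadruples G)) :=
    Fintype.ofFinite _
  have : ∀ g : ConjAct G, Fintype (MulAction.fixedBy (commutingQuadruples G) g) :=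
    fun _ => Fintype.ofFinite _
  have key := MulAction.sum_card_fixedBy_eq_card_orbits_mul_card_group
    (ConjAct G) (commutingQuadruples G)
  have hG : Fintype.card (ConjAct G) = Nat.card G := by
    rw [← Nat.card_eq_fintype_card]
    exact Nat.card_congr ConjAct.ofConjAct.toEquiv
  rw [hG] at key
  rw [Nat.card_eq_fintype_card (α := MulAction.orbitRel.Quotient _ _)]
  refine key.symm.trans (Fintype.sum_equiv ConjAct.ofConjAct.toEquiv _ _ fun g => ?_)
  rw [← Nat.card_eq_fintype_card, Nat.card_congr (fixedByCommutingQuadruplesEquiv g),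
    Nat.card_prod, sq]
  rfl

variable [Fintype G] [DecidableEq G]

theorem card_commutingPairsIn_one :
    Nat.card (CommutingPairsIn (1 : G)) = ∑ a : G, #{b : G | a * b = b * a} := by
  rw [Nat.card_eq_fintype_card, Fintype.card_subtype, card_filter, Fintype.sum_prod_type]
  simp only [one_mul, mul_one, and_self, and_true, card_filter]

theorem card_commutingPairsIn_of_commute {g : G}
    (hg : ∀ a b, g * a = a * g → g * b = b * g → a * b = b * a) :
    Nat.card (CommutingPairsIn g) = #{a : G | g * a = a * g} ^ 2 := by
  rw [Nat.card_eq_fintype_card, Fintype.card_subtype, sq, ← card_product]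
  congr 1
  ext ⟨a, b⟩
  simpa using hg a b

end Burnside

section Encoding

/-- The `x`-th decimal digit of `n`. -/
def digit (n x : ℕ) : ℕ := n / 10 ^ x % 10

/-- Whether the self-maps of `{0, …, 4}` with digit sequences `m` and `n` commute. -/
def digitsCommute (m n : ℕ) : Bool :=
  (List.range 5).all fun x => Nat.beq (digit m (digit n x)) (digit n (digit m x))

/-- The value table of a permutation of `Fin 5`, as a sequence of decimal digits. -/
def permCode (g : alternatingGroup (Fin 5)) : ℕ := ∑ x : Fin 5, 10 ^ x.val * (g.1 x).val

/-- The codes of the even permutations of `Fin 5`. -/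
def evenCodes : Finset ℕ :=
  {1234, 1342, 1423, 2143, 2314, 2431, 3124, 3241, 3412, 4132,
    4213, 4321, 10243, 10324, 10432, 12034, 12340, 12403, 13042, 13204,
    13420, 14023, 14230, 14302, 20134, 20341, 20413, 21043, 21304, 21430,
    23014, 23140, 23401, 24031, 24103, 24310, 30142, 30214, 30421, 31024,
    31240, 31402, 32041, 32104, 32410, 34012, 34120, 34201, 40123, 40231,
    40312, 41032, 41203, 41320, 42013, 42130, 42301, 43021, 43102, 43210}

theorem digit_permCode (g : alternatingGroup (Fin 5)) (x : Fin 5) :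
    digit (permCode g) x = g.1 x := by
  have h₀ := (g.1 0).isLt
  have h₁ := (g.1 1).isLt
  have h₂ := (g.1 2).isLt
  have h₃ := (g.1 3).isLt
  have h₄ := (g.1 4).isLt
  fin_cases x <;> simp [digit, permCode, Fin.sum_univ_five] <;> omega

theorem permCode_injective : Function.Injective permCode := fun g h hgh =>
  Subtype.ext <| Equiv.ext fun x => Fin.ext <| by
    rw [← digit_permCode, ← digit_permCode, hgh]

theorem permCode_one : permCode 1 = 43210 := by
  simp [permCode, Fin.sum_univ_five]

theorem image_permCode : univ.image permCode = evenCodes := by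
  decide +kernel

theorem permCode_mem (g : alternatingGroup (Fin 5)) : permCode g ∈ evenCodes :=
  image_permCode ▸ mem_image_of_mem _ (mem_univ g)

theorem digitsCommute_permCode (g h : alternatingGroup (Fin 5)) :
    digitsCommute (permCode g) (permCode h) = true ↔ g * h = h * g := by
  have hx (x : Fin 5) : digit (permCode g) (digit (permCode h) x) =
      digit (permCode h) (digit (permCode g) x) ↔ (g * h).1 x = (h * g).1 x := by
    simp [digit_permCode, Fin.ext_iff]
  rw [Subtype.ext_iff, Equiv.ext_iff, ← forall_congr' hx]
  simp [digitsCommute, Fin.forall_iff]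

theorem card_centralizer_eq (g : alternatingGroup (Fin 5)) :
    #{a | g * a = a * g} = #{n ∈ evenCodes | digitsCommute (permCode g) n} := by
  rw [← image_permCode, filter_image, card_image_of_injective _ permCode_injective]
  simp only [digitsCommute_permCode]

end Encoding

theorem commute_of_commute_ne_one {g : alternatingGroup (Fin 5)} (hg : g ≠ 1)
    (a b : alternatingGroup (Fin 5)) (ha : g * a = a * g) (hb : g * b = b * g) :
    a * b = b * a := by
  have key : ∀ n ∈ evenCodes, n = 43210 ∨
      ∀ k ∈ {k ∈ evenCodes | digitsCommute n k}, ∀ l ∈ {l ∈ evenCodes | digitsCommute n l},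
        digitsCommute k l = true := by
    decide +kernel
  rw [← digitsCommute_permCode] at ha hb ⊢
  refine ((key _ (permCode_mem g)).resolve_left fun h => hg ?_) _
    (mem_filter.2 ⟨permCode_mem a, ha⟩) _ (mem_filter.2 ⟨permCode_mem b, hb⟩)
  exact permCode_injective (h.trans permCode_one.symm)

theorem sum_card_centralizer :
    ∑ g : alternatingGroup (Fin 5), #{a | g * a = a * g} = 300 := by
  simp only [card_centralizer_eq]
  rw [← sum_image (f := fun n => #{m ∈ evenCodes | digitsCommute n m}) permCode_injective.injOn,
    image_permCode]
  decide +kernel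

theorem sum_card_centralizer_pow_four :
    ∑ g ∈ univ.erase (1 : alternatingGroup (Fin 5)), #{a | g * a = a * g} ^ 4 = 20460 := by
  simp only [card_centralizer_eq]
  rw [← sum_image (f := fun n => #{m ∈ evenCodes | digitsCommute n m} ^ 4)
    permCode_injective.injOn, image_erase permCode_injective, image_permCode, permCode_one]
  decide +kernel

theorem card_commutingPairsIn_one_alternatingGroup_five :
    Nat.card (CommutingPairsIn (1 : alternatingGroup (Fin 5))) = 300 := by
  rw [card_commutingPairsIn_one, sum_card_centralizer]

theorem card_commutingPairsIn_sq_of_ne_one {g : alternatingGroup (Fin 5)} (hg : g ≠ 1) :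
    Nat.card (CommutingPairsIn g) ^ 2 = #{a | g * a = a * g} ^ 4 := by
  rw [card_commutingPairsIn_of_commute (commute_of_commute_ne_one hg)]
  ring

theorem sum_card_commutingPairsIn_sq :
    ∑ g : alternatingGroup (Fin 5), Nat.card (CommutingPairsIn g) ^ 2 = 110460 := by
  rw [← add_sum_erase _ _ (mem_univ 1), card_commutingPairsIn_one_alternatingGroup_five,
    sum_congr rfl fun g hg => card_commutingPairsIn_sq_of_ne_one (ne_of_mem_erase hg),
    sum_card_centralizer_pow_four]
  norm_num

/-- The number of orbits of the alternating group `A₅` acting by simultaneous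
conjugation `g • (a, b, c, d) = (g a g⁻¹, g b g⁻¹, g c g⁻¹, g d g⁻¹)` on the
set of quadruples `(a, b, c, d) ∈ A₅⁴` with `a * b = b * a` and
`c * d = d * c` is exactly `1841`.  Equivalently, there are `1841` conjugacy
classes of homomorphisms from `(ℤ × ℤ) ∗ (ℤ × ℤ)` to `A₅`. -/
theorem card_orbits_conj_commuting_quadruples_alternatingGroup_five :
    Nat.card (Quot (fun
        (x y : {p : alternatingGroup (Fin 5) × alternatingGroup (Fin 5) ×
                    alternatingGroup (Fin 5) × alternatingGroup (Fin 5) //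
                p.1 * p.2.1 = p.2.1 * p.1 ∧
                p.2.2.1 * p.2.2.2 = p.2.2.2 * p.2.2.1}) =>
      ∃ g : alternatingGroup (Fin 5),
        (g * x.val.1 * g⁻¹, g * x.val.2.1 * g⁻¹,
         g * x.val.2.2.1 * g⁻¹, g * x.val.2.2.2 * g⁻¹) = y.val)) = 1841 := by
  have hcard : Nat.card (alternatingGroup (Fin 5)) = 60 := by
    rw [nat_card_alternatingGroup, Nat.card_fin]
    rfl
  have key := card_orbits_commutingQuadruples_mul_card (G := alternatingGroup (Fin 5))
  rw [sum_card_commutingPairsIn_sq, hcard] at key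
  have hrel (x y : commutingQuadruples (alternatingGroup (Fin 5))) :
      (∃ g : alternatingGroup (Fin 5),
        (g * x.val.1 * g⁻¹, g * x.val.2.1 * g⁻¹,
         g * x.val.2.2.1 * g⁻¹, g * x.val.2.2.2 * g⁻¹) = y.val) ↔
      MulAction.orbitRel (ConjAct (alternatingGroup (Fin 5))) _ x y := by
    rw [Setoid.comm', MulAction.orbitRel_apply]
    exact ⟨fun ⟨g, hg⟩ => ⟨ConjAct.toConjAct g, Subtype.ext hg⟩,
      fun ⟨g, hg⟩ => ⟨ConjAct.ofConjAct g, congrArg Subtype.val hg⟩⟩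
  have hquot : Nat.card (MulAction.orbitRel.Quotient (ConjAct (alternatingGroup (Fin 5)))
      (commutingQuadruples (alternatingGroup (Fin 5)))) = 1841 := by
    lia
  exact (Nat.card_congr (Quot.congr (Equiv.refl _) hrel)).trans hquot
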